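/- Let a be a positive integer and let B = 2a+1. Then sup over θ ∈ S_B, over k ≥ 1, and over integers N with q_k + q_{k−1} ≤ N < q_{k+1} (where p_k/q_k are the convergents of θ) of N·H(θ, N) equals 1 + (a²+3a+2)/√(4a²+12a+5). -/

import Mathlib

/-- The points `0, {θ}, {2θ}, …, {Nθ}, 1` used in the three-gap theorem. -/
def gapPoints (θ : ℝ) (N : ℕ) : Set ℝ :=
  insert 1 {x : ℝ | ∃ k : ℕ, k ≤ N ∧ x = Int.fract (k * θ)}

/-- The gap set `G(θ, N)`: the set of differences between consecutive points among
`0, {θ}, {2θ}, …, {Nθ}, 1` sorted in ascending order. -/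
def gapSet (θ : ℝ) (N : ℕ) : Set ℝ :=
  {d : ℝ | ∃ a ∈ gapPoints θ N, ∃ b ∈ gapPoints θ N,
    a < b ∧ (∀ c ∈ gapPoints θ N, ¬(a < c ∧ c < b)) ∧ d = b - a}

/-- `H(θ, N)`, the largest gap in the gap set `G(θ, N)`. -/
noncomputable def maxGap (θ : ℝ) (N : ℕ) : ℝ := sSup (gapSet θ N)

/-- `θ` has all partial quotients `a_i` (for `i ≥ 1`) of its simple continued fraction
expansion bounded by `B`.  (Index `i` of `partDens` corresponds to `a_{i+1}`.) -/
def PartQuotBounded (θ : ℝ) (B : ℕ) : Prop :=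
  ∀ i : ℕ, ∀ a ∈ ((GenContFract.of θ).partDens.get? i), a ≤ (B : ℝ)

/-- `S_B`: the set of irrational numbers in `(0,1)` with partial quotients bounded by `B`. -/
def SB (B : ℕ) : Set ℝ :=
  {θ : ℝ | Irrational θ ∧ θ ∈ Set.Ioo (0 : ℝ) 1 ∧ PartQuotBounded θ B}

/-- The orbit of `θ` under the Gauss map. -/
noncomputable def gaussOrbit (θ : ℝ) : ℕ → ℝ
  | 0 => θ
  | n + 1 => Int.fract (gaussOrbit θ n)⁻¹

/-- The partial quotient `a_{n+1}` of `θ ∈ (0,1)`. -/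
noncomputable def gaussDigit (θ : ℝ) (n : ℕ) : ℤ := ⌊(gaussOrbit θ n)⁻¹⌋

/-- The convergent denominators with index shifted by one: `cfDen θ (k + 1) = q_k`. -/
noncomputable def cfDen (θ : ℝ) : ℕ → ℤ
  | 0 => 0
  | 1 => 1
  | n + 2 => gaussDigit θ n * cfDen θ (n + 1) + cfDen θ n

/-- The convergent numerators with index shifted by one: `cfNum θ (k + 1) = p_k`. -/
noncomputable def cfNum (θ : ℝ) : ℕ → ℤ
  | 0 => 1
  | 1 => 0
  | n + 2 => gaussDigit θ n * cfNum θ (n + 1) + cfNum θ n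

section GaussMap

variable {θ : ℝ}

lemma gaussOrbit_mem (hirr : Irrational θ) (hθ : θ ∈ Set.Ioo (0 : ℝ) 1) (n : ℕ) :
    Irrational (gaussOrbit θ n) ∧ gaussOrbit θ n ∈ Set.Ioo (0 : ℝ) 1 := by
  induction n with
  | zero => exact ⟨hirr, hθ⟩
  | succ n ih =>
    have h1 : Irrational (gaussOrbit θ (n + 1)) := by
      exact ih.1.inv.sub_intCast ⌊(gaussOrbit θ n)⁻¹⌋
    refine ⟨h1, lt_of_le_of_ne (Int.fract_nonneg _) (Ne.symm h1.ne_zero), Int.fract_lt_one _⟩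

lemma inv_gaussOrbit (n : ℕ) :
    (gaussOrbit θ n)⁻¹ = gaussDigit θ n + gaussOrbit θ (n + 1) := by
  exact (Int.floor_add_fract _).symm

lemma one_le_gaussDigit (hirr : Irrational θ) (hθ : θ ∈ Set.Ioo (0 : ℝ) 1) (n : ℕ) :
    1 ≤ gaussDigit θ n := by
  have h := (gaussOrbit_mem hirr hθ n).2
  rw [gaussDigit, Int.le_floor]
  simpa using (one_le_inv₀ h.1).2 h.2.le

lemma cfDen_nonneg_and_pos (hirr : Irrational θ) (hθ : θ ∈ Set.Ioo (0 : ℝ) 1) (n : ℕ) :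
    0 ≤ cfDen θ n ∧ 1 ≤ cfDen θ (n + 1) := by
  induction n with
  | zero => simp [cfDen]
  | succ n ih =>
    refine ⟨by linarith [ih.2], ?_⟩
    have := one_le_gaussDigit hirr hθ n
    simp only [cfDen]
    nlinarith

lemma le_cfDen_succ (hirr : Irrational θ) (hθ : θ ∈ Set.Ioo (0 : ℝ) 1) (n : ℕ) :
    (n : ℤ) ≤ cfDen θ (n + 1) := by
  induction n with
  | zero => simp [cfDen]
  | succ n ih =>
    have h1 := one_le_gaussDigit hirr hθ n
    have h2 := cfDen_nonneg_and_pos hirr hθ n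
    rcases n with _ | n
    · simpa [cfDen] using h1
    · have h3 := cfDen_nonneg_and_pos hirr hθ n
      rw [cfDen]
      push_cast at ih ⊢
      nlinarith

lemma cfDen_det (θ : ℝ) (n : ℕ) :
    cfDen θ (n + 1) * cfNum θ n - cfNum θ (n + 1) * cfDen θ n = (-1) ^ n := by
  induction n with
  | zero => simp [cfDen, cfNum]
  | succ n ih =>
    rw [pow_succ, ← ih]
    simp only [cfDen, cfNum]
    ring

lemma cfDen_error_succ (hirr : Irrational θ) (hθ : θ ∈ Set.Ioo (0 : ℝ) 1) (n : ℕ) :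
    cfDen θ (n + 1) * θ - cfNum θ (n + 1) =
      -gaussOrbit θ n * (cfDen θ n * θ - cfNum θ n) := by
  induction n with
  | zero => simp [cfDen, cfNum, gaussOrbit]
  | succ n ih =>
    have h := (gaussOrbit_mem hirr hθ n).2.1
    have h2 := inv_gaussOrbit (θ := θ) n
    have h3 : gaussOrbit θ (n + 1) = (gaussOrbit θ n)⁻¹ - gaussDigit θ n := by linarith
    have h4 : cfDen θ n * θ - cfNum θ n =
        -(gaussOrbit θ n)⁻¹ * (cfDen θ (n + 1) * θ - cfNum θ (n + 1)) := by
      rw [ih]; field_simp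
    rw [h3]
    simp only [cfDen, cfNum]
    push_cast
    linear_combination h4

/-- The errors `D_{n-1} = |q_{n-1}θ - p_{n-1}|` alternate in sign. -/
lemma exists_cfDen_error (hirr : Irrational θ) (hθ : θ ∈ Set.Ioo (0 : ℝ) 1) (n : ℕ) :
    ∃ D : ℝ, 0 < D ∧ cfDen θ n * θ - cfNum θ n = (-1) ^ (n + 1) * D := by
  induction n with
  | zero => exact ⟨1, one_pos, by simp [cfDen, cfNum]⟩
  | succ n ih =>
    obtain ⟨D, hD, h⟩ := ih
    refine ⟨gaussOrbit θ n * D, mul_pos (gaussOrbit_mem hirr hθ n).2.1 hD, ?_⟩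
    rw [cfDen_error_succ hirr hθ, h]
    ring

lemma intFractPair_stream_eq (hirr : Irrational θ) (hθ : θ ∈ Set.Ioo (0 : ℝ) 1) (n : ℕ) :
    GenContFract.IntFractPair.stream θ (n + 1) =
      some ⟨gaussDigit θ n, gaussOrbit θ (n + 1)⟩ := by
  induction n with
  | zero =>
    have h0 : Int.fract θ = θ := Int.fract_eq_self.2 ⟨hθ.1.le, hθ.2⟩
    have : (GenContFract.IntFractPair.of θ).fr ≠ 0 := by
      simpa [GenContFract.IntFractPair.of, h0] using hθ.1.ne'
    rw [GenContFract.IntFractPair.stream_succ_of_some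
      (GenContFract.IntFractPair.stream_zero θ) this]
    simp [GenContFract.IntFractPair.of, h0, gaussDigit, gaussOrbit]
  | succ n ih =>
    have h := (gaussOrbit_mem hirr hθ (n + 1)).2.1.ne'
    rw [GenContFract.IntFractPair.stream_succ_of_some ih h]
    rfl

lemma of_s_get? (hirr : Irrational θ) (hθ : θ ∈ Set.Ioo (0 : ℝ) 1) (n : ℕ) :
    (GenContFract.of θ).s.get? n = some ⟨1, (gaussDigit θ n : ℝ)⟩ :=
  GenContFract.get?_of_eq_some_of_succ_get?_intFractPair_stream
    (intFractPair_stream_eq hirr hθ n)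

lemma of_dens_eq (hirr : Irrational θ) (hθ : θ ∈ Set.Ioo (0 : ℝ) 1) (n : ℕ) :
    (GenContFract.of θ).dens n = cfDen θ (n + 1) ∧
      (GenContFract.of θ).dens (n + 1) = cfDen θ (n + 2) := by
  induction n with
  | zero =>
    refine ⟨by simp [cfDen], ?_⟩
    rw [GenContFract.first_den_eq (of_s_get? hirr hθ 0)]
    simp [cfDen]
  | succ n ih =>
    refine ⟨ih.2, ?_⟩
    rw [GenContFract.dens_recurrence (of_s_get? hirr hθ (n + 1)) ih.1 ih.2]
    simp [cfDen]

lemma partQuotBounded_iff (hirr : Irrational θ) (hθ : θ ∈ Set.Ioo (0 : ℝ) 1) (B : ℕ) :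
    PartQuotBounded θ B ↔ ∀ n, gaussDigit θ n ≤ B := by
  refine forall_congr' fun n => ?_
  simp only [GenContFract.partDens, Stream'.Seq.map_get?, of_s_get? hirr hθ n]
  simp
  norm_cast

end GaussMap

/-- The value of the continued fraction `[0; 1, B, 1, B, …]`. -/
noncomputable def altCF (B : ℝ) : ℝ := (Real.sqrt (B ^ 2 + 4 * B) - B) / 2

section AltCF

variable {B : ℝ}

lemma altCF_sq (hB : 0 ≤ B) : altCF B ^ 2 = B - B * altCF B := by
  have := Real.sq_sqrt (show 0 ≤ B ^ 2 + 4 * B by positivity)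
  unfold altCF
  linear_combination this / 4

lemma altCF_mem (hB : 1 ≤ B) : altCF B ∈ Set.Ioo (0 : ℝ) 1 := by
  have h1 : B < Real.sqrt (B ^ 2 + 4 * B) := Real.lt_sqrt_of_sq_lt (by linarith)
  have h2 : Real.sqrt (B ^ 2 + 4 * B) < B + 2 := by
    rw [Real.sqrt_lt' (by linarith)]; linarith
  constructor <;> unfold altCF <;> linarith

lemma altCF_inv (hB : 1 ≤ B) : (altCF B)⁻¹ = 1 + (B + altCF B)⁻¹ := by
  have h := altCF_mem hB
  have h1 : B + altCF B ≠ 0 := by linarith [h.1]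
  have h2 := h.1.ne'
  field_simp
  linarith [altCF_sq (show 0 ≤ B by linarith)]

lemma irrational_altCF {B : ℕ} (hB : 1 ≤ B) : Irrational (altCF B) := by
  have h : Irrational (Real.sqrt ((B ^ 2 + 4 * B : ℕ) : ℝ)) := by
    rw [irrational_sqrt_natCast_iff]
    rintro ⟨r, hr⟩
    have h1 : B + 1 < r := by nlinarith
    have h2 : r < B + 2 := by nlinarith
    omega
  have h2 := (h.sub_natCast B).div_natCast (two_ne_zero)
  unfold altCF
  convert h2 using 4 <;> push_cast <;> rfl

end AltCF

section Gaps

variable {θ : ℝ} {N : ℕ}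

lemma fract_mem_gapPoints {n : ℤ} (h0 : 0 ≤ n) (hN : n ≤ N) :
    Int.fract (n * θ) ∈ gapPoints θ N := by
  lift n to ℕ using h0
  exact Or.inr ⟨n, by exact_mod_cast hN, by simp⟩

lemma gapPoints_subset : gapPoints θ N ⊆ Set.Icc 0 1 := by
  rintro x (rfl | ⟨k, -, rfl⟩)
  · simp
  · exact ⟨Int.fract_nonneg _, (Int.fract_lt_one _).le⟩

lemma bddAbove_gapSet : BddAbove (gapSet θ N) := by
  refine ⟨1, ?_⟩
  rintro d ⟨a, ha, b, hb, -, -, rfl⟩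
  linarith [(gapPoints_subset ha).1, (gapPoints_subset hb).2]

lemma exists_gapPoint_right {i w P : ℤ} {δ L : ℝ} (h0 : 0 ≤ i + w) (hN : i + w ≤ N)
    (hw : w * θ = P + δ) (hδ : 0 < δ) (hL : δ ≤ L) :
    ∃ c ∈ gapPoints θ N, Int.fract (i * θ) < c ∧ c ≤ Int.fract (i * θ) + L := by
  by_cases h : Int.fract (i * θ) + δ < 1
  · refine ⟨_, fract_mem_gapPoints h0 hN, ?_⟩
    have : Int.fract (((i + w : ℤ) : ℝ) * θ) = Int.fract (i * θ) + δ := by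
      rw [Int.fract_eq_iff]
      refine ⟨by linarith [Int.fract_nonneg (i * θ)], h, P + ⌊i * θ⌋, ?_⟩
      rw [Int.fract]
      push_cast
      linear_combination hw
    rw [this]
    constructor <;> linarith
  · exact ⟨1, Or.inl rfl, Int.fract_lt_one _, by linarith⟩

lemma exists_gapPoint_left {j w P r : ℤ} {b δ L : ℝ} (h0 : 0 ≤ j + w) (hN : j + w ≤ N)
    (hb : b = j * θ + r) (hb0 : 0 < b) (hb1 : b ≤ 1)
    (hw : w * θ = P - δ) (hδ : 0 < δ) (hL : δ ≤ L) :
    ∃ c ∈ gapPoints θ N, b - L ≤ c ∧ c < b := by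
  by_cases h : 0 ≤ b - δ
  · refine ⟨_, fract_mem_gapPoints h0 hN, ?_⟩
    have : Int.fract (((j + w : ℤ) : ℝ) * θ) = b - δ := by
      rw [Int.fract_eq_iff]
      refine ⟨h, by linarith, P - r, ?_⟩
      push_cast
      linear_combination hw - hb
    rw [this]
    constructor <;> linarith
  · exact ⟨0, Or.inr ⟨0, by simp⟩, by linarith, hb0⟩

lemma exists_eq_fract_of_mem {x : ℝ} (hx : x ∈ gapPoints θ N) (h1 : x < 1) :
    ∃ i : ℤ, 0 ≤ i ∧ i ≤ N ∧ x = Int.fract (i * θ) := by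
  rcases hx with rfl | ⟨k, hk, rfl⟩
  · exact absurd h1 (lt_irrefl _)
  · exact ⟨k, by positivity, by exact_mod_cast hk, by simp⟩

lemma exists_eq_add_of_mem {x : ℝ} (hx : x ∈ gapPoints θ N) :
    ∃ i r : ℤ, 0 ≤ i ∧ i ≤ N ∧ x = i * θ + r := by
  rcases hx with rfl | ⟨k, hk, rfl⟩
  · exact ⟨0, 1, by simp⟩
  · refine ⟨k, -⌊k * θ⌋, by positivity, by exact_mod_cast hk, ?_⟩
    rw [Int.fract]
    push_cast
    ring

/-- If `q'θ` and `qθ` are at signed distances `sD'` and `-sD` from integers and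
`m q + q' ≤ N`, then no gap exceeds `D' - (m - 1) D`. -/
lemma maxGap_le {q q' p p' m : ℤ} {s D D' : ℝ} (hs : s = 1 ∨ s = -1)
    (hq : 0 ≤ q) (hq' : 0 ≤ q') (hm : 1 ≤ m) (hN : m * q + q' ≤ N)
    (h : q * θ - p = -s * D) (h' : q' * θ - p' = s * D') (hD : 0 < D) (hD' : m * D ≤ D') :
    maxGap θ N ≤ D' - (m - 1) * D := by
  have hL : D ≤ D' - (m - 1) * D := by linarith
  have hqN : (m - 1) * q + q' + q ≤ N := by linarith
  have hw : ((q' + (m - 1) * q : ℤ) : ℝ) * θ =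
      (p' + (m - 1) * p : ℤ) + s * (D' - (m - 1) * D) := by
    push_cast
    linear_combination h' + (m - 1 : ℝ) * h
  have hw2 : ((-q : ℤ) : ℝ) * θ = (-p : ℤ) + s * D := by
    push_cast
    linear_combination -h
  have hpos : 0 ≤ (m - 1) * q := mul_nonneg (by linarith) hq
  refine Real.sSup_le ?_ (by linarith)
  rintro d ⟨a, ha, b, hb, hab, hgap, rfl⟩
  rcases hs with rfl | rfl
  · obtain ⟨i, hi0, hiN, rfl⟩ := exists_eq_fract_of_mem ha
      (hab.trans_le (gapPoints_subset hb).2)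
    obtain ⟨c, hc, h1, h2⟩ : ∃ c ∈ gapPoints θ N, Int.fract (i * θ) < c ∧
        c ≤ Int.fract (i * θ) + (D' - (m - 1) * D) := by
      rcases lt_or_ge i q with hiq | hiq
      · exact exists_gapPoint_right (by linarith) (by linarith) hw (by linarith) (by linarith)
      · exact exists_gapPoint_right (by linarith) (by linarith) hw2 (by linarith) (by linarith)
    have := hgap c hc
    push Not at this
    linarith [this h1]
  · obtain ⟨j, r, hj0, hjN, hbj⟩ := exists_eq_add_of_mem hb
    have hb0 : 0 < b := (gapPoints_subset ha).1.trans_lt hab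
    have hb1 := (gapPoints_subset hb).2
    obtain ⟨c, hc, h1, h2⟩ : ∃ c ∈ gapPoints θ N, b - (D' - (m - 1) * D) ≤ c ∧ c < b := by
      rcases lt_or_ge j q with hjq | hjq
      · exact exists_gapPoint_left (w := q' + (m - 1) * q)
          (P := p' + (m - 1) * p) (δ := D' - (m - 1) * D) (by linarith) (by linarith) hbj
          hb0 hb1 (by rw [hw]; ring) (by linarith) le_rfl
      · exact exists_gapPoint_left (w := -q) (P := -p) (δ := D) (by linarith) (by linarith)
          hbj hb0 hb1 (by rw [hw2]; ring) hD hL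
    have := hgap c hc
    push Not at this
    by_contra hcon
    linarith [this (by linarith)]

/-- The bound of `maxGap_le` is attained when `N = (m + 1) q + q' - 2`. -/
lemma le_maxGap {q q' p p' m e : ℤ} {D D' : ℝ} (hq : 2 ≤ q) (hq' : 0 ≤ q') (hm : 1 ≤ m)
    (hN : (N : ℤ) = (m + 1) * q + q' - 2) (he : e ^ 2 = 1) (hdet : q * p' - p * q' = e)
    (h : q * θ - p = -D) (h' : q' * θ - p' = D') (hD : 0 < D) (hD' : m * D ≤ D') :
    D' - (m - 1) * D ≤ maxGap θ N := by
  have hL : D ≤ D' - (m - 1) * D := by linarith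
  have hD'0 : 0 < D' := by
    have : (1 : ℝ) ≤ m := by exact_mod_cast hm
    nlinarith
  have key : ∀ n r : ℤ, 0 ≤ n → n ≤ N → 0 < (n - (q - 1)) * θ + r →
      D' - (m - 1) * D ≤ (n - (q - 1)) * θ + r := by
    intro n r hn0 hnN hpos
    by_contra! hlt
    obtain ⟨α, hα⟩ : ∃ α, α = -e * (r * q + (n - (q - 1)) * p) := ⟨_, rfl⟩
    obtain ⟨β, hβ⟩ : ∃ β, β = e * (r * q' + (n - (q - 1)) * p') := ⟨_, rfl⟩
    have hw : n - (q - 1) = α * q' + β * q := by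
      rw [hα, hβ]
      linear_combination -(n - (q - 1)) * he - e * (n - (q - 1)) * hdet
    have hr : -r = α * p' + β * p := by
      rw [hα, hβ]
      linear_combination r * he + e * r * hdet
    have hwR : (n - (q - 1) : ℝ) = α * q' + β * q := by exact_mod_cast hw
    have hrR : (-r : ℝ) = α * p' + β * p := by exact_mod_cast hr
    have hval : (n - (q - 1)) * θ + r = α * D' - β * D := by
      linear_combination θ * hwR - hrR + α * h' + β * h
    rw [hval] at hpos hlt
    rcases le_or_gt α 0 with hα0 | hα0
    · have hβ0 : β ≤ -1 := by
        by_contra! hcon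
        have h1 : (0 : ℝ) ≤ β := by exact_mod_cast (by omega : 0 ≤ β)
        have h2 : (α : ℝ) ≤ 0 := by exact_mod_cast hα0
        nlinarith
      nlinarith
    · have hβm : m ≤ β := by
        by_contra! hcon
        have h1 : (β : ℝ) ≤ m - 1 := by exact_mod_cast (by omega : β ≤ m - 1)
        have h2 : (1 : ℝ) ≤ α := by exact_mod_cast hα0
        nlinarith
      nlinarith
  have hmq : q ≤ m * q := by nlinarith
  set x := Int.fract (((q - 1 : ℤ) : ℝ) * θ) with hx
  have hx' : x = (q - 1) * θ - ⌊((q - 1 : ℤ) : ℝ) * θ⌋ := by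
    rw [hx, Int.fract]; push_cast; ring
  have hx1 : x < 1 := Int.fract_lt_one _
  have key2 : ∀ c ∈ gapPoints θ N, x < c → x + (D' - (m - 1) * D) ≤ c := by
    intro c hc hxc
    obtain ⟨n, r, hn0, hnN, rfl⟩ := exists_eq_add_of_mem hc
    have := key n (r + ⌊((q - 1 : ℤ) : ℝ) * θ⌋) hn0 hnN (by push_cast at *; linarith)
    push_cast at *
    linarith
  have hx2 := key2 1 (Or.inl rfl) hx1
  refine le_csSup bddAbove_gapSet ⟨x, fract_mem_gapPoints (by linarith) (by linarith),
    x + (D' - (m - 1) * D), ?_, by linarith, ?_, by ring⟩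
  · rcases hx2.eq_or_lt with h1 | h1
    · exact Or.inl h1
    · have : Int.fract (((m * q + q' - 1 : ℤ) : ℝ) * θ) = x + (D' - (m - 1) * D) := by
        rw [Int.fract_eq_iff]
        refine ⟨by linarith [Int.fract_nonneg (((q - 1 : ℤ) : ℝ) * θ)], h1,
          ⌊((q - 1 : ℤ) : ℝ) * θ⌋ + p' + (m - 1) * p, ?_⟩
        rw [hx']
        push_cast
        linear_combination h' + (m - 1 : ℝ) * h
      rw [← this]
      exact fract_mem_gapPoints (by linarith) (by linarith)
  · rintro c hc ⟨h1, h2⟩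
    linarith [key2 c hc h1]

end Gaps

section BoundedQuotients

variable {θ : ℝ} {B : ℕ}

lemma gaussOrbit_le_altCF (hB : 1 ≤ B) (hirr : Irrational θ) (hθ : θ ∈ Set.Ioo (0 : ℝ) 1)
    (hdig : ∀ n, gaussDigit θ n ≤ B) (n : ℕ) : gaussOrbit θ n ≤ altCF B := by
  have hB' : (1 : ℝ) ≤ B := by exact_mod_cast hB
  have hM := altCF_mem hB'
  have hM2 := altCF_sq (show (0 : ℝ) ≤ B by linarith)
  have hmem := fun n => (gaussOrbit_mem hirr hθ n).2
  have hbdd : BddAbove (Set.range (gaussOrbit θ)) :=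
    ⟨1, by rintro _ ⟨n, rfl⟩; exact (hmem n).2.le⟩
  set S := ⨆ n, gaussOrbit θ n with hS
  have hle : ∀ n, gaussOrbit θ n ≤ S := fun n => le_ciSup hbdd n
  have hS0 : 0 < S := (hmem 0).1.trans_le (hle 0)
  have hSle : S ≤ (B + S) / (B + S + 1) := by
    refine ciSup_le fun n => ?_
    have h1 := inv_gaussOrbit (θ := θ) n
    have h2 := inv_gaussOrbit (θ := θ) (n + 1)
    have h3 : (1 : ℝ) ≤ gaussDigit θ n := by exact_mod_cast one_le_gaussDigit hirr hθ n
    have h4 : (gaussDigit θ (n + 1) : ℝ) ≤ B := by exact_mod_cast hdig (n + 1)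
    have h5 : (B + S)⁻¹ ≤ gaussOrbit θ (n + 1) := by
      rw [inv_le_comm₀ (by linarith) (hmem _).1, h2]
      linarith [hle (n + 2)]
    have h6 : (B + S) / (B + S + 1) = (1 + (B + S)⁻¹)⁻¹ := by
      have : (B : ℝ) + S ≠ 0 := by positivity
      field_simp
    rw [h6, le_inv_comm₀ (hmem _).1 (by positivity), h1]
    linarith
  rw [le_div_iff₀ (by linarith)] at hSle
  refine (hle n).trans ?_
  by_contra! hcon
  nlinarith [mul_pos (sub_pos.2 hcon) (show 0 < S + altCF B + B by linarith [hM.1])]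

lemma cfDen_le_altCF_mul_add_one (hB : 1 ≤ B) (hirr : Irrational θ)
    (hθ : θ ∈ Set.Ioo (0 : ℝ) 1) (hdig : ∀ n, gaussDigit θ n ≤ B) (n : ℕ) :
    (cfDen θ n : ℝ) ≤ altCF B * cfDen θ (n + 1) + 1 := by
  have hB' : (1 : ℝ) ≤ B := by exact_mod_cast hB
  have hM := altCF_mem hB'
  have hM2 := altCF_sq (show (0 : ℝ) ≤ B by linarith)
  have hpos : ∀ n, (0 : ℝ) ≤ cfDen θ n := fun n => by
    exact_mod_cast (cfDen_nonneg_and_pos hirr hθ n).1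
  have hd1 : ∀ n, (1 : ℝ) ≤ gaussDigit θ n := fun n => by
    exact_mod_cast one_le_gaussDigit hirr hθ n
  have hdB : ∀ n, (gaussDigit θ n : ℝ) ≤ B := fun n => by exact_mod_cast hdig n
  induction n using Nat.twoStepInduction with
  | zero => simp [cfDen]; linarith [hM.1]
  | one =>
    have := mul_nonneg hM.1.le (hpos 2)
    simp only [cfDen] at this ⊢
    push_cast at this ⊢
    linarith
  | more n ih _ =>
    have h1 : (cfDen θ (n + 2) : ℝ) = gaussDigit θ n * cfDen θ (n + 1) + cfDen θ n := by
      simp [cfDen]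
    have h2 : (cfDen θ (n + 3) : ℝ) =
        gaussDigit θ (n + 1) * cfDen θ (n + 2) + cfDen θ (n + 1) := by
      simp [cfDen]
    have h3 : (cfDen θ (n + 2) : ℝ) ≤ B * cfDen θ (n + 1) + cfDen θ n := by
      rw [h1]; gcongr; exacts [hpos _, hdB n]
    have h4 : (cfDen θ (n + 2) : ℝ) + cfDen θ (n + 1) ≤ cfDen θ (n + 3) := by
      rw [h2]; nlinarith [hd1 (n + 1), hpos (n + 2)]
    have h5 := mul_le_mul_of_nonneg_left h4 hM.1.le
    have h6 := mul_le_mul_of_nonneg_left h3 (show 0 ≤ 1 - altCF B by linarith [hM.2])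
    have h7 := mul_le_mul_of_nonneg_left ih (show 0 ≤ 1 - altCF B by linarith [hM.2])
    have h8 : (1 - altCF B) * (B * cfDen θ (n + 1)) =
        (altCF B ^ 2) * cfDen θ (n + 1) := by rw [hM2]; ring
    change (cfDen θ (n + 2) : ℝ) ≤ altCF B * cfDen θ (n + 3) + 1
    nlinarith [hM.1]

lemma cfDen_mul_error_add (n : ℕ) {D D' : ℝ}
    (h' : cfDen θ n * θ - cfNum θ n = (-1) ^ (n + 1) * D')
    (h : cfDen θ (n + 1) * θ - cfNum θ (n + 1) = (-1) ^ (n + 2) * D) :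
    cfDen θ (n + 1) * D' + cfDen θ n * D = 1 := by
  have hdet : (cfDen θ (n + 1) * cfNum θ n - cfNum θ (n + 1) * cfDen θ n : ℝ) = (-1) ^ n := by
    exact_mod_cast cfDen_det θ n
  have hsq : ((-1 : ℝ) ^ n) * (-1) ^ n = 1 := by rw [← mul_pow]; simp
  rw [pow_succ] at h'
  rw [pow_add] at h
  linear_combination (-1 : ℝ) ^ n * (cfDen θ (n + 1) * h' - cfDen θ n * h + hdet) +
    (1 - cfDen θ (n + 1) * D' - cfDen θ n * D) * hsq

end BoundedQuotients

section Extremal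

variable {B : ℕ}

lemma gaussOrbit_altCF (hB : 1 ≤ B) (j : ℕ) :
    gaussOrbit (altCF B) (2 * j) = altCF B ∧
      gaussOrbit (altCF B) (2 * j + 1) = (B + altCF B)⁻¹ ∧
      gaussDigit (altCF B) (2 * j) = 1 ∧ gaussDigit (altCF B) (2 * j + 1) = B := by
  have hB' : (1 : ℝ) ≤ B := by exact_mod_cast hB
  have hM := altCF_mem hB'
  have hinv : 0 < ((B : ℝ) + altCF B)⁻¹ ∧ ((B : ℝ) + altCF B)⁻¹ < 1 :=
    ⟨inv_pos.2 (by linarith [hM.1]), inv_lt_one_of_one_lt₀ (by linarith [hM.1])⟩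
  have hfl : ⌊(altCF B)⁻¹⌋ = 1 := by
    rw [altCF_inv hB', Int.floor_eq_iff]
    push_cast
    constructor <;> linarith
  have hfl2 : ⌊(B : ℝ) + altCF B⌋ = B := by
    rw [Int.floor_eq_iff]
    push_cast
    constructor <;> linarith [hM.1, hM.2]
  have h1 : ∀ i, gaussOrbit (altCF B) i = altCF B →
      gaussOrbit (altCF B) (i + 1) = (B + altCF B)⁻¹ := by
    intro i hi
    rw [gaussOrbit, hi, Int.fract, hfl, altCF_inv hB']
    push_cast
    ring
  have h2 : gaussOrbit (altCF B) (2 * j) = altCF B := by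
    induction j with
    | zero => rfl
    | succ j ih =>
      rw [show 2 * (j + 1) = (2 * j + 1) + 1 by ring, gaussOrbit, h1 _ ih, inv_inv, Int.fract,
        hfl2]
      push_cast
      ring
  refine ⟨h2, h1 _ h2, ?_, ?_⟩
  · rw [gaussDigit, h2, hfl]
  · rw [gaussDigit, h1 _ h2, inv_inv, hfl2]

lemma altCF_mul_cfDen_le (hB : 1 ≤ B) (j : ℕ) :
    altCF B * cfDen (altCF B) (2 * j + 2) ≤ cfDen (altCF B) (2 * j + 1) := by
  have hB' : (1 : ℝ) ≤ B := by exact_mod_cast hB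
  have hM := altCF_mem hB'
  have hM2 := altCF_sq (show (0 : ℝ) ≤ B by linarith)
  have hdig := gaussOrbit_altCF hB
  induction j with
  | zero =>
    have h := (hdig 0).2.2.1
    simp only [mul_zero, cfDen] at h ⊢
    rw [h]
    simpa using hM.2.le
  | succ j ih =>
    have h1 : (cfDen (altCF B) (2 * j + 3) : ℝ) =
        B * cfDen (altCF B) (2 * j + 2) + cfDen (altCF B) (2 * j + 1) := by
      have : cfDen (altCF B) (2 * j + 3) =
        B * cfDen (altCF B) (2 * j + 2) + cfDen (altCF B) (2 * j + 1) := by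
        rw [cfDen, (hdig j).2.2.2]
      exact_mod_cast this
    have h2 : (cfDen (altCF B) (2 * j + 4) : ℝ) =
        cfDen (altCF B) (2 * j + 3) + cfDen (altCF B) (2 * j + 2) := by
      have h := (hdig (j + 1)).2.2.1
      have : cfDen (altCF B) (2 * j + 4) =
        cfDen (altCF B) (2 * j + 3) + cfDen (altCF B) (2 * j + 2) := by
        rw [cfDen, show 2 * j + 2 = 2 * (j + 1) by ring, h, one_mul]
        rfl
      exact_mod_cast this
    change altCF B * (cfDen (altCF B) (2 * j + 4) : ℝ) ≤ cfDen (altCF B) (2 * j + 3)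
    rw [h2, h1]
    have h6 := mul_le_mul_of_nonneg_left ih (show 0 ≤ 1 - altCF B by linarith [hM.2])
    linear_combination h6 + (cfDen (altCF B) (2 * j + 2) : ℝ) * hM2

lemma altCF_mem_SB (hB : 1 ≤ B) : altCF B ∈ SB B := by
  have hmem := altCF_mem (show (1 : ℝ) ≤ B by exact_mod_cast hB)
  refine ⟨irrational_altCF hB, hmem, (partQuotBounded_iff (irrational_altCF hB) hmem B).2 ?_⟩
  intro n
  obtain ⟨j, rfl | rfl⟩ := Nat.even_or_odd' n
  · rw [(gaussOrbit_altCF hB j).2.2.1]; exact_mod_cast hB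
  · rw [(gaussOrbit_altCF hB j).2.2.2]

end Extremal

/-- The real inequality behind the upper bound. -/
lemma mul_gap_le {q q' D D' M B t x H : ℝ} (hD : 0 < D)
    (hM : 0 < M) (ht : 2 ≤ t) (htD : t * D ≤ D') (hdet : q * D' + q' * D = 1)
    (hy : D' ≤ (B + M) * D) (hqM : q' ≤ M * q + 1) (hx0 : 0 ≤ x) (hx : x ≤ t * q + q' - 1)
    (hH : H ≤ D' - (t - 2) * D) :
    x * H * (B + 2 * M) ≤ (t + M) * (B + 2 + M - t) := by
  obtain ⟨y, rfl⟩ : ∃ y, D' = y * D := ⟨D' / D, by field_simp⟩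
  have hty : t ≤ y := le_of_mul_le_mul_right htD hD
  have hyB : y ≤ B + M := le_of_mul_le_mul_right hy hD
  have h1 : (t * q + q' - 1) * (y + M) ≤ (t + M) * (y * q + q') := by
    linear_combination (y - t) * hqM + hM + ht
  have h2 : (y - (t - 2)) * (B + 2 * M) ≤ (B + 2 + M - t) * (y + M) := by
    nlinarith [mul_nonneg (sub_nonneg.2 hyB) (show 0 ≤ M + (t - 2) by linarith)]
  have hBM : 0 < B + 2 * M := by linarith
  have hyM : 0 < y + M := by linarith
  have h3 : (y * q + q') * D = 1 := by linear_combination hdet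
  calc x * H * (B + 2 * M) ≤ x * ((y - (t - 2)) * D) * (B + 2 * M) := by
        gcongr; linarith
    _ = x * D * ((y - (t - 2)) * (B + 2 * M)) := by ring
    _ ≤ x * D * ((B + 2 + M - t) * (y + M)) := by gcongr
    _ = x * (y + M) * D * (B + 2 + M - t) := by ring
    _ ≤ (t + M) * (y * q + q') * D * (B + 2 + M - t) := by
        have : 0 ≤ B + 2 + M - t := by linarith
        have := (mul_le_mul_of_nonneg_right hx hyM.le).trans h1
        gcongr
    _ = (t + M) * (B + 2 + M - t) := by linear_combination (t + M) * (B + 2 + M - t) * h3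

/-- The real inequality behind the lower bound. -/
lemma le_mul_gap {q q' D D' M B t H : ℝ} (hq : 0 < q) (hq' : 0 ≤ q') (hD : 0 < D)
    (hM : 0 < M) (ht : 2 ≤ t) (htB : t ≤ B) (hdet : q * D' + q' * D = 1)
    (hy : D' = (B + M) * D) (hqM : M * q ≤ q') (hx0 : 0 ≤ t * q + q' - 2)
    (hH : D' - (t - 2) * D ≤ H) :
    (t + M) * (B + 2 + M - t) / (B + 2 * M) - 2 / q ≤ (t * q + q' - 2) * H := by
  subst hy
  have h3 : ((B + M) * q + q') * D = 1 := by linear_combination hdet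
  have hBM : 0 < B + 2 * M := by linarith
  have hs : 0 ≤ B + 2 + M - t := by linarith
  have hBt : 0 ≤ B + M - t := by linarith
  have h1 : (t + M) * ((B + M) * q + q') ≤ (t * q + q') * (B + 2 * M) := by
    linear_combination (B + M - t) * hqM
  have h4 : (B + 2 + M - t) * D ≤ 1 / q := by
    rw [le_div_iff₀ hq, ← h3]
    nlinarith [mul_nonneg hD.le hq', mul_nonneg (mul_nonneg hD.le hq.le) (sub_nonneg.2 ht)]
  have h5 : (t + M) * (B + 2 + M - t) / (B + 2 * M) ≤ (t * q + q') * ((B + 2 + M - t) * D) := by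
    rw [div_le_iff₀ hBM]
    calc (t + M) * (B + 2 + M - t)
        = (t + M) * ((B + M) * q + q') * (D * (B + 2 + M - t)) := by
          linear_combination -(t + M) * (B + 2 + M - t) * h3
      _ ≤ (t * q + q') * (B + 2 * M) * (D * (B + 2 + M - t)) := by gcongr
      _ = _ := by ring
  have h6 := mul_le_mul_of_nonneg_left hH hx0
  have h7 : 2 / q = 2 * (1 / q) := by ring
  rw [h7]
  linarith

/-- The extremal value in terms of `altCF`. -/
lemma extremal_value_eq (a : ℕ) :
    1 + ((a : ℝ) ^ 2 + 3 * a + 2) / Real.sqrt (4 * (a : ℝ) ^ 2 + 12 * a + 5) =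
      ((a + 1 : ℝ) + altCF (2 * a + 1 : ℕ)) * ((2 * a + 1 : ℕ) + 2 + altCF (2 * a + 1 : ℕ) -
        (a + 1 : ℝ)) / ((2 * a + 1 : ℕ) + 2 * altCF (2 * a + 1 : ℕ)) := by
  have hB : (0 : ℝ) ≤ (2 * a + 1 : ℕ) := by positivity
  have hM2 := altCF_sq hB
  have hsq : Real.sqrt (4 * (a : ℝ) ^ 2 + 12 * a + 5) =
      (2 * a + 1 : ℕ) + 2 * altCF (2 * a + 1 : ℕ) := by
    unfold altCF
    rw [show 4 * (a : ℝ) ^ 2 + 12 * a + 5 =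
      ((2 * a + 1 : ℕ) : ℝ) ^ 2 + 4 * (2 * a + 1 : ℕ) by push_cast; ring]
    ring
  have hpos : 0 < Real.sqrt (4 * (a : ℝ) ^ 2 + 12 * a + 5) := Real.sqrt_pos.2 (by positivity)
  rw [hsq] at hpos ⊢
  rw [eq_div_iff hpos.ne', add_mul, div_mul_cancel₀ _ hpos.ne']
  push_cast at hM2 ⊢
  linear_combination -hM2

lemma mul_maxGap_le_extremal {a : ℕ} (ha : 1 ≤ a) {θ : ℝ} (hθ : θ ∈ SB (2 * a + 1)) (n N : ℕ)
    (h1 : cfDen θ (n + 1) + cfDen θ n ≤ N) (h2 : (N : ℤ) < cfDen θ (n + 2)) :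
    (N : ℝ) * maxGap θ N ≤
      1 + ((a : ℝ) ^ 2 + 3 * a + 2) / Real.sqrt (4 * (a : ℝ) ^ 2 + 12 * a + 5) := by
  obtain ⟨hirr, hmem, hpq⟩ := hθ
  have hdig := (partQuotBounded_iff hirr hmem _).1 hpq
  have hM := altCF_mem (B := (2 * a + 1 : ℕ))
    (by push_cast; linarith [Nat.cast_nonneg (α := ℝ) a])
  have hqM := cfDen_le_altCF_mul_add_one (by omega) hirr hmem hdig n
  have hz1 := gaussOrbit_le_altCF (by omega) hirr hmem hdig (n + 1)
  obtain ⟨hq', hq⟩ := cfDen_nonneg_and_pos hirr hmem n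
  obtain ⟨D', hD', hE'⟩ := exists_cfDen_error hirr hmem n
  have hz := (gaussOrbit_mem hirr hmem n).2
  have hz' := (gaussOrbit_mem hirr hmem (n + 1)).2
  obtain ⟨D, hD⟩ : ∃ D, D = gaussOrbit θ n * D' := ⟨_, rfl⟩
  have hE : cfDen θ (n + 1) * θ - cfNum θ (n + 1) = (-1) ^ (n + 2) * D := by
    rw [cfDen_error_succ hirr hmem, hE', hD]; ring
  have hDpos : 0 < D := hD ▸ mul_pos hz.1 hD'
  have hdet := cfDen_mul_error_add n hE' hE
  have hDD : D' = (gaussDigit θ n + gaussOrbit θ (n + 1)) * D := by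
    rw [← inv_gaussOrbit, hD, inv_mul_cancel_left₀ hz.1.ne']
  have hdigR : (gaussDigit θ n : ℝ) ≤ (2 * a + 1 : ℕ) := by exact_mod_cast hdig n
  rw [cfDen] at h2
  generalize cfDen θ n = q' at *
  generalize cfDen θ (n + 1) = q at *
  obtain ⟨m, hm⟩ : ∃ m, m = (N - q') / q := ⟨_, rfl⟩
  have hm1 : m * q ≤ N - q' := hm ▸ Int.ediv_mul_le _ (by omega)
  have hm2 : N - q' < (m + 1) * q := by
    have := Int.lt_ediv_add_one_mul_self ((N : ℤ) - q') (show 0 < q by omega)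
    rwa [← hm] at this
  have hmpos : 1 ≤ m := by
    rw [hm, Int.le_ediv_iff_mul_le (by omega)]; omega
  have hmb : m + 1 ≤ gaussDigit θ n := by
    have : m < gaussDigit θ n := lt_of_mul_lt_mul_right (by linarith) (show 0 ≤ q by omega)
    omega
  have hmR : (1 : ℝ) ≤ m := by exact_mod_cast hmpos
  have hmbR : (m + 1 : ℝ) ≤ gaussDigit θ n := by exact_mod_cast hmb
  have htD : (m + 1 : ℝ) * D ≤ D' := by
    rw [hDD]; exact mul_le_mul_of_nonneg_right (by linarith [hz'.1]) hDpos.le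
  have hs := neg_one_pow_eq_or ℝ (n + 1)
  have hH := maxGap_le (q := q) (p := cfNum θ (n + 1)) hs (by omega) hq' hmpos (by linarith)
    (by rw [hE, pow_succ _ (n + 1)]; ring) hE' hDpos (by linarith)
  have hNR : (N : ℝ) ≤ (m + 1) * q + q' - 1 := by
    exact_mod_cast (by linarith : (N : ℤ) ≤ (m + 1) * q + q' - 1)
  have key := mul_gap_le (B := (2 * a + 1 : ℕ)) (t := m + 1) (H := maxGap θ N)
    hDpos hM.1 (by linarith)
    htD hdet (by rw [hDD]; gcongr) hqM (Nat.cast_nonneg N) hNR (by linarith)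
  rw [extremal_value_eq, le_div_iff₀ (by linarith [hM.1, hdigR])]
  refine key.trans ?_
  have hint : (0 : ℝ) ≤ (m - a) * (m - a - 1) := by
    have : 0 ≤ (m - a) * (m - a - 1) := by
      rcases le_or_gt m a with h | h <;> nlinarith
    exact_mod_cast this
  push_cast
  nlinarith

lemma exists_lt_mul_maxGap {a : ℕ} (ha : 1 ≤ a) {v : ℝ}
    (hv : v < 1 + ((a : ℝ) ^ 2 + 3 * a + 2) / Real.sqrt (4 * (a : ℝ) ^ 2 + 12 * a + 5)) :
    ∃ θ ∈ SB (2 * a + 1), ∃ n N : ℕ, 1 ≤ n ∧ cfDen θ (n + 1) + cfDen θ n ≤ N ∧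
      (N : ℤ) < cfDen θ (n + 2) ∧ v < N * maxGap θ N := by
  have hB : 1 ≤ 2 * a + 1 := by omega
  have hθ := altCF_mem_SB hB
  have hqM' := altCF_mul_cfDen_le hB
  have horb := gaussOrbit_altCF hB
  rw [extremal_value_eq] at hv
  have hM := altCF_mem (B := (2 * a + 1 : ℕ))
    (by push_cast; linarith [Nat.cast_nonneg (α := ℝ) a])
  refine ⟨_, hθ, ?_⟩
  obtain ⟨hirr, hmem, -⟩ := hθ
  set θ := altCF (2 * a + 1 : ℕ)
  obtain ⟨V, hV⟩ : ∃ V : ℝ, V = ((a + 1 : ℝ) + θ) * ((2 * a + 1 : ℕ) + 2 + θ -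
        (a + 1 : ℝ)) / ((2 * a + 1 : ℕ) + 2 * θ) := ⟨_, rfl⟩
  rw [← hV] at hv
  obtain ⟨j, hj⟩ := exists_nat_gt (2 / (V - v))
  have hj0 : (0 : ℝ) < j := (div_pos two_pos (sub_pos.2 hv)).trans hj
  have hj1 : 1 ≤ j := by exact_mod_cast hj0
  have hqj := le_cfDen_succ hirr hmem (2 * j + 1)
  have hqM := hqM' j
  obtain ⟨hq', hq⟩ := cfDen_nonneg_and_pos hirr hmem (2 * j + 1)
  obtain ⟨D', hD', hE'⟩ := exists_cfDen_error hirr hmem (2 * j + 1)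
  have hz := (gaussOrbit_mem hirr hmem (2 * j + 1)).2
  obtain ⟨D, hD⟩ : ∃ D, D = gaussOrbit θ (2 * j + 1) * D' := ⟨_, rfl⟩
  have hE : cfDen θ (2 * j + 1 + 1) * θ - cfNum θ (2 * j + 1 + 1) =
      (-1) ^ (2 * j + 1 + 2) * D := by
    rw [cfDen_error_succ hirr hmem, hE', hD]; ring
  have hDpos : 0 < D := hD ▸ mul_pos hz.1 hD'
  have hdet := cfDen_mul_error_add _ hE' hE
  have hdet2 := cfDen_det θ (2 * j + 1)
  have hrec : cfDen θ (2 * j + 1 + 2) =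
      (2 * a + 1 : ℕ) * cfDen θ (2 * j + 1 + 1) + cfDen θ (2 * j + 1) := by
    rw [cfDen, (horb j).2.2.2]
  have hDD : D' = ((2 * a + 1 : ℕ) + θ) * D := by
    have : ((2 * a + 1 : ℕ) : ℝ) + θ ≠ 0 := by
      linarith [hM.1, Nat.cast_nonneg (α := ℝ) (2 * a + 1)]
    rw [hD, (horb j).2.1, mul_inv_cancel_left₀ this]
  change θ * (cfDen θ (2 * j + 1 + 1) : ℝ) ≤ _ at hqM
  refine ⟨2 * j + 1, ?_⟩
  rw [hrec]
  generalize cfDen θ (2 * j + 1) = q' at *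
  generalize cfDen θ (2 * j + 1 + 1) = q at *
  have hs : (-1 : ℝ) ^ (2 * j + 1 + 1) = 1 := by
    rw [show 2 * j + 1 + 1 = 2 * (j + 1) by ring, pow_mul]; simp
  rw [pow_succ _ (2 * j + 1 + 1), hs] at hE
  rw [hs] at hE'
  push_cast at hqj
  have haq : q ≤ a * q := by nlinarith
  obtain ⟨N, hN⟩ : ∃ N : ℕ, (N : ℤ) = (a + 1) * q + q' - 2 :=
    ⟨((a + 1) * q + q' - 2).toNat, Int.toNat_of_nonneg (by linarith)⟩
  have hNR : (N : ℝ) = (a + 1) * q + q' - 2 := by exact_mod_cast hN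
  have haR : (1 : ℝ) ≤ a := by exact_mod_cast ha
  have hH := le_maxGap (θ := θ) (m := a) (D := D) (D' := D') (by omega) hq' (by exact_mod_cast ha) hN
    (by rw [← pow_mul]; simp) hdet2 (by rw [hE]; ring) (by rw [hE']; ring) hDpos
    (by rw [hDD]; exact mul_le_mul_of_nonneg_right (by push_cast; linarith [hM.1]) hDpos.le)
  have hqR : (j : ℝ) ≤ q := by exact_mod_cast (by omega : (j : ℤ) ≤ q)
  refine ⟨N, by omega, by linarith, by push_cast; nlinarith, ?_⟩
  have key := le_mul_gap (B := (2 * a + 1 : ℕ)) (t := a + 1) (H := maxGap θ N)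
    (by linarith) (by exact_mod_cast hq') hDpos hM.1 (by linarith) (by push_cast; linarith) hdet
    hDD hqM (by rw [← hNR]; positivity) (by push_cast at hH; linarith)
  rw [← hV, ← hNR] at key
  have : 2 / (q : ℝ) < V - v := by
    rw [div_lt_iff₀ (sub_pos.2 hv)] at hj
    rw [div_lt_iff₀ (by linarith)]
    nlinarith
  linarith

/-- **Case 2.2 of the proof of Theorem 4.**  For odd `B = 2a+1` (`a ≥ 1`), the supremum of
`N·H(θ,N)` over `θ ∈ S_B`, `k ≥ 1` and integers `N` with `q_k + q_{k-1} ≤ N < q_{k+1}`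
equals `1 + (a²+3a+2)/√(4a²+12a+5)`. -/
theorem sup_case2_odd (a : ℕ) (ha : 1 ≤ a) :
    sSup {x : ℝ | ∃ θ ∈ SB (2 * a + 1), ∃ k : ℕ, 1 ≤ k ∧ ∃ N : ℕ,
        ((GenContFract.of θ).dens k + (GenContFract.of θ).dens (k - 1) ≤ (N : ℝ) ∧
          (N : ℝ) < (GenContFract.of θ).dens (k + 1)) ∧
        x = (N : ℝ) * maxGap θ N} =
      1 + ((a : ℝ) ^ 2 + 3 * a + 2) / Real.sqrt (4 * (a : ℝ) ^ 2 + 12 * a + 5) := by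
  have hdens : ∀ θ ∈ SB (2 * a + 1), ∀ k N : ℕ, 1 ≤ k →
      (((GenContFract.of θ).dens k + (GenContFract.of θ).dens (k - 1) ≤ (N : ℝ) ∧
          (N : ℝ) < (GenContFract.of θ).dens (k + 1)) ↔
        (cfDen θ (k + 1) + cfDen θ k ≤ N ∧ (N : ℤ) < cfDen θ (k + 2))) := by
    rintro θ ⟨hirr, hθ, -⟩ k N hk
    obtain ⟨k, rfl⟩ := Nat.exists_eq_add_of_le' hk
    rw [Nat.add_sub_cancel, (of_dens_eq hirr hθ _).2, (of_dens_eq hirr hθ _).2,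
      (of_dens_eq hirr hθ _).1]
    norm_cast
  have hlow : ∀ v < 1 + ((a : ℝ) ^ 2 + 3 * a + 2) / Real.sqrt (4 * (a : ℝ) ^ 2 + 12 * a + 5),
      ∃ x ∈ {x : ℝ | ∃ θ ∈ SB (2 * a + 1), ∃ k : ℕ, 1 ≤ k ∧ ∃ N : ℕ,
        ((GenContFract.of θ).dens k + (GenContFract.of θ).dens (k - 1) ≤ (N : ℝ) ∧
          (N : ℝ) < (GenContFract.of θ).dens (k + 1)) ∧
        x = (N : ℝ) * maxGap θ N}, v < x := by
    intro v hv
    obtain ⟨θ, hθ, k, N, hk, h1, h2, h3⟩ := exists_lt_mul_maxGap ha hv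
    exact ⟨_, ⟨θ, hθ, k, hk, N, (hdens θ hθ k N hk).2 ⟨h1, h2⟩, rfl⟩, h3⟩
  refine csSup_eq_of_forall_le_of_forall_lt_exists_gt ?_ ?_ hlow
  · obtain ⟨x, hx, -⟩ := hlow _ (sub_one_lt _)
    exact ⟨x, hx⟩
  · rintro x ⟨θ, hθ, k, hk, N, hN, rfl⟩
    obtain ⟨h1, h2⟩ := (hdens θ hθ k N hk).1 hN
    exact mul_maxGap_le_extremal ha hθ k N h1 h2
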